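/- Let $G$ be a group, $H \leq G$ a subgroup, and $T$ a left $G$-set; regard $T$ as an $H$-set by restriction. Then the translation category (action category) $B_{G/H\times T}G$ of the diagonal $G$-action on $G/H\times T$ is equivalent to the translation category $B_{T}H$ of the $H$-action on $T$: there is an equivalence of categories $\mathrm{ActionCategory}(G,\, G/H\times T) \simeq \mathrm{ActionCategory}(H,\, T)$. -/

import Mathlib

open CategoryTheory

/-- The functor `t ↦ (H, t)`. -/
def quotProdFunctor (G : Type*) [Group G] (H : Subgroup G) (T : Type*) [MulAction G T] :
    ActionCategory H T ⥤ ActionCategory G ((G ⧸ H) × T) where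
  obj t := ActionCategory.objEquiv G ((G ⧸ H) × T) (((1 : G) : G ⧸ H), t.back)
  map {a b} f := Subtype.mk (p := fun g : G =>
      g • ((((1 : G) : G ⧸ H), a.back) : (G ⧸ H) × T) = (((1 : G) : G ⧸ H), b.back))
    ((show H from f.val) : G) (by
      have h : (show H from f.val) • a.back = b.back := f.property
      refine Prod.ext ?_ h
      change ((((show H from f.val) : G) * 1 : G) : G ⧸ H) = ((1 : G) : G ⧸ H)
      rw [QuotientGroup.eq]
      simp)
  map_id _ := rfl
  map_comp _ _ := rfl

/-- The translation category `B_{G/H × T} G` of the diagonal `G`-action on `G/H × T` is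
equivalent to the translation category `B_T H` of the restricted `H`-action on `T`. -/
theorem actionCategory_quotientProd_equiv (G : Type*) [Group G] (H : Subgroup G)
    (T : Type*) [MulAction G T] :
    Nonempty (ActionCategory G ((G ⧸ H) × T) ≌ ActionCategory H T) := by
  have h1 : (quotProdFunctor G H T).Faithful := ⟨by
    intro a b f g h
    have h2 := congrArg Subtype.val h
    exact Subtype.ext (Subtype.ext h2)⟩
  have h2 : (quotProdFunctor G H T).Full := ⟨by
    intro a b f
    obtain ⟨g, hg⟩ := f
    change G at g
    change g • ((((1 : G) : G ⧸ H), a.back) : (G ⧸ H) × T) = (((1 : G) : G ⧸ H), b.back) at hg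
    have ha : ((g * 1 : G) : G ⧸ H) = ((1 : G) : G ⧸ H) := congrArg Prod.fst hg
    have hb : g • a.back = b.back := congrArg Prod.snd hg
    have hm : g ∈ H := by
      rw [QuotientGroup.eq] at ha
      simpa using ha
    exact ⟨Subtype.mk (p := fun k : H => k • a.back = b.back) ⟨g, hm⟩ hb, rfl⟩⟩
  have h3 : (quotProdFunctor G H T).EssSurj := ⟨by
    rintro ⟨⟨⟩, x, t⟩
    induction x using QuotientGroup.induction_on with
    | H g =>
    refine ⟨ActionCategory.objEquiv H T (g⁻¹ • t), ⟨Groupoid.isoEquivHom _ _ |>.symm ?_⟩⟩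
    refine Subtype.mk (p := fun k : G => k • ((((1 : G) : G ⧸ H), g⁻¹ • t) : (G ⧸ H) × T)
      = ((g : G ⧸ H), t)) g ?_
    refine Prod.ext ?_ (smul_inv_smul g t)
    change ((g * 1 : G) : G ⧸ H) = (g : G ⧸ H)
    rw [mul_one]⟩
  have h4 : (quotProdFunctor G H T).IsEquivalence := {}
  exact ⟨(quotProdFunctor G H T).asEquivalence.symm⟩
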